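/- arXiv:1102.3622 — 2 statements merged into one kernel-verified Lean document; each statement's English description precedes it below -/
import Mathlib

section
/- Let k be a field and E a finite set with |E| = n ≥ 1. For m ≥ 1 let N_m be the free k-vector space with basis the ordered partitions (E_1, …, E_m) of E into m pairwise disjoint nonempty subsets with union E (so N_m = 0 for m > n), and set N_0 = 0. Define d : N_m → N_{m−1} by d(E_1, …, E_m) = Σ_{i=1}^{m−1} (−1)^{i} (E_1, …, E_i ∪ E_{i+1}, …, E_m). Then H_m(N_*) = 0 for all m ≠ n, and H_n(N_*) is a one-dimensional k-vector space. -/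
/- STATEMENT 4: for a finite set `E` with `|E| = n ≥ 1`, the normalized bar complex
`N_m` (free on ordered partitions of `E` into `m` nonempty blocks, with merging
differential) has `H_m(N) = 0` for `m ≠ n` and `H_n(N)` one-dimensional.
Since there are no ordered partitions of `E` into more than `n` nonempty blocks,
`N_{n+1} = 0` and `H_n(N) = ker (d : N_n → N_{n−1})`. -/

open Finset

/-- `f` is an ordered partition of `E` into nonempty blocks: a tuple of pairwise
disjoint nonempty subsets of `E` whose union is `E`. -/
def IsPart {α : Type} [DecidableEq α] (E : Finset α) {r : ℕ}
    (f : Fin r → Finset α) : Prop :=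
  (∀ i, f i ≠ ∅) ∧ (∀ i j, i ≠ j → Disjoint (f i) (f j)) ∧ Finset.univ.sup f = E

instance {α : Type} [DecidableEq α] (E : Finset α) (r : ℕ) :
    DecidablePred (IsPart E (r := r)) := fun _ => by unfold IsPart; infer_instance

/-- The basis vector of the free `k`-module indexed by `x`, if `x` satisfies the
predicate `P`; `0` otherwise (in the intended uses `P x` always holds). -/
noncomputable def bas (k : Type) [Field k] {β : Type} (P : β → Prop) [DecidablePred P]
    (x : β) : {y : β // P y} →₀ k :=
  if h : P x then Finsupp.single ⟨x, h⟩ (1 : k) else 0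

/-- Merge blocks `i` and `i+1` of a tuple of length `r+1`, yielding a tuple of
length `r`. -/
def merge {α : Type} [DecidableEq α] {r : ℕ} (i : ℕ) (f : Fin (r + 1) → Finset α)
    (j : Fin r) : Finset α :=
  if j.val < i then f j.castSucc
  else if j.val = i then f j.castSucc ∪ f j.succ
  else f j.succ

/-- `N_m`: the free `k`-module on ordered partitions of `E` into `m` nonempty
blocks (so `N_0 = 0` and `N_m = 0` for `m > |E|` when `E` is nonempty). -/
noncomputable abbrev NMod (k : Type) [Field k] {α : Type} [DecidableEq α]
    (E : Finset α) (m : ℕ) : Type :=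
  {f : Fin m → Finset α // IsPart E f} →₀ k

/-- The differential `d : N_{m+1} → N_m`,
`d(E_1, …, E_{m+1}) = Σ_{i=1}^{m} (−1)^i (E_1, …, E_i ∪ E_{i+1}, …, E_{m+1})`
(1-based index `i` corresponds to the 0-based merge position `i − 1`). -/
noncomputable def nD (k : Type) [Field k] {α : Type} [DecidableEq α]
    (E : Finset α) (m : ℕ) : NMod k E (m + 1) →ₗ[k] NMod k E m :=
  Finsupp.lsum k fun q => LinearMap.toSpanSingleton k _
    (∑ i ∈ Finset.range m, ((-1 : k) ^ (i + 1)) • bas k (IsPart E) (merge i q.val))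

namespace BarAux

variable {k : Type} [Field k] {α : Type} [DecidableEq α]

/-- Recursive description of ordered partitions as lists. -/
def PL : Finset α → List (Finset α) → Prop
  | E, [] => E = ∅
  | E, x :: l => x ≠ ∅ ∧ x ⊆ E ∧ PL (E \ x) l

/-- Free module on lists of finite sets. -/
abbrev FL (k : Type) [Field k] (α : Type) [DecidableEq α] : Type := List (Finset α) →₀ k

/-- Basis vector. -/
noncomputable def e (k : Type) [Field k] {α : Type} [DecidableEq α] (l : List (Finset α)) :
    FL k α := Finsupp.single l 1

/-- Linear extension. -/
noncomputable def ext (f : List (Finset α) → FL k α) : FL k α →ₗ[k] FL k α :=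
  Finsupp.linearCombination k f

@[simp] lemma ext_e (f : List (Finset α) → FL k α) (l) : ext f (e k l) = f l := by
  simp [ext, e]

lemma hom_ext {f g : FL k α →ₗ[k] FL k α} (h : ∀ l, f (e k l) = g (e k l)) : f = g := by
  apply Finsupp.lhom_ext'
  intro l
  apply LinearMap.ext_ring
  simpa [e] using h l

/-- Prepend a block. -/
noncomputable def c (x : Finset α) : FL k α →ₗ[k] FL k α := ext (fun l => e k (x :: l))

@[simp] lemma c_e (x : Finset α) (l) : c x (e k l) = e k (x :: l) := by simp [c]

/-- Merge into the head. -/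
noncomputable def mer (x : Finset α) : FL k α →ₗ[k] FL k α :=
  ext (fun l => match l with
    | [] => 0
    | y :: l => e k ((x ∪ y) :: l))

@[simp] lemma mer_nil (x : Finset α) : mer x (e k []) = 0 := by simp [mer]

@[simp] lemma mer_cons (x y : Finset α) (l) : mer x (e k (y :: l)) = e k ((x ∪ y) :: l) := by
  simp [mer]

@[simp] lemma mer_c (x y : Finset α) (w : FL k α) : mer x (c y w) = c (x ∪ y) w := by
  have : (mer x) ∘ₗ (c y) = c (k := k) (x ∪ y) := hom_ext (by simp)
  exact DFunLike.congr_fun this w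

/-- Differential on basis vectors. -/
noncomputable def D0 : List (Finset α) → FL k α
  | [] => 0
  | x :: l => - mer x (e k l) - c x (D0 l)

/-- Differential. -/
noncomputable def D : FL k α →ₗ[k] FL k α := ext D0

@[simp] lemma D_nil : D (e k ([] : List (Finset α))) = 0 := by simp [D, D0]

@[simp] lemma D_cons (x : Finset α) (l) :
    D (e k (x :: l)) = - mer x (e k l) - c x (D (e k l)) := by simp [D, D0]

@[simp] lemma D_c (x : Finset α) (w : FL k α) : D (c x w) = - mer x w - c x (D w) := by
  have : D ∘ₗ (c x) = - mer (k := k) x - c x ∘ₗ D := hom_ext (by simp)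
  exact DFunLike.congr_fun this w

/-- Signed shuffle with `[{a}]` on basis vectors. -/
noncomputable def sh0 (a : α) : List (Finset α) → FL k α
  | [] => e k [{a}]
  | x :: l => e k ({a} :: x :: l) - c x (sh0 a l)

/-- Signed shuffle with `[{a}]`. -/
noncomputable def sh (a : α) : FL k α →ₗ[k] FL k α := ext (sh0 a)

@[simp] lemma sh_nil (a : α) : sh a (e k []) = e k [{a}] := by simp [sh, sh0]

@[simp] lemma sh_cons (a : α) (x : Finset α) (l) :
    sh a (e k (x :: l)) = e k ({a} :: x :: l) - c x (sh a (e k l)) := by simp [sh, sh0]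

@[simp] lemma sh_c (a : α) (x : Finset α) (w : FL k α) :
    sh a (c x w) = c {a} (c x w) - c x (sh a w) := by
  have : sh a ∘ₗ (c x) = c (k := k) {a} ∘ₗ c x - c x ∘ₗ sh a := hom_ext (by simp)
  exact DFunLike.congr_fun this w

lemma mer_sh (a : α) (x : Finset α) (w : FL k α) :
    mer x (sh a w) = sh a (mer x w) + c ({a} ∪ x) w - c {a} (mer x w) := by
  have : mer x ∘ₗ sh a = sh (k := k) a ∘ₗ mer x + c ({a} ∪ x) - c {a} ∘ₗ mer x := by
    apply hom_ext
    rintro (_ | ⟨y, l⟩)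
    · simp [union_comm]
    · simp [union_comm]
      abel
  exact DFunLike.congr_fun this w

lemma D_sh (a : α) (w : FL k α) : D (sh a w) = - sh a (D w) := by
  have : D ∘ₗ sh a = - (sh (k := k) a ∘ₗ D) := by
    apply hom_ext
    intro l
    induction l with
    | nil => simp
    | cons x l ih =>
      simp only [LinearMap.comp_apply, LinearMap.neg_apply] at ih ⊢
      simp [ih, mer_sh]
      abel
  exact DFunLike.congr_fun this w

/-- Homotopy on basis vectors. -/
noncomputable def H0 (a : α) : List (Finset α) → FL k α
  | [] => 0
  | x :: l => if a ∈ x then (if x = {a} then 0 else - c (x.erase a) (sh a (e k l)))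
      else - c x (H0 a l)

/-- Homotopy. -/
noncomputable def H (a : α) : FL k α →ₗ[k] FL k α := ext (H0 a)

lemma H_nil (a : α) : H a (e k []) = 0 := by simp [H, H0]

lemma H_cons_sing (a : α) (w : FL k α) : H a (c {a} w) = 0 := by
  have : H a ∘ₗ c {a} = (0 : FL k α →ₗ[k] FL k α) := hom_ext (by simp [H, H0])
  exact DFunLike.congr_fun this w

lemma H_cons_mem (a : α) (x : Finset α) (h : a ∈ x) (h' : x ≠ {a}) (w : FL k α) :
    H a (c x w) = - c (x.erase a) (sh a w) := by
  have : H a ∘ₗ c x = - (c (k := k) (x.erase a) ∘ₗ sh a) := hom_ext (by simp [H, H0, h, h'])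
  exact DFunLike.congr_fun this w

lemma H_cons_not (a : α) (x : Finset α) (h : a ∉ x) (w : FL k α) :
    H a (c x w) = - c x (H a w) := by
  have : H a ∘ₗ c x = - (c (k := k) x ∘ₗ H a) := hom_ext (by simp [H, H0, h])
  exact DFunLike.congr_fun this w

/-- Remove a leading `{a}`, and kill everything else. -/
noncomputable def R (a : α) : FL k α →ₗ[k] FL k α :=
  ext (fun l => match l with
    | [] => 0
    | x :: l => if x = {a} then e k l else 0)

lemma R_nil (a : α) : R a (e k []) = 0 := by simp [R]

lemma R_c_sing (a : α) (w : FL k α) : R a (c {a} w) = w := by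
  have : R a ∘ₗ c {a} = (LinearMap.id : FL k α →ₗ[k] FL k α) := hom_ext (by simp [R])
  exact DFunLike.congr_fun this w

lemma R_c_ne (a : α) (x : Finset α) (h : x ≠ {a}) (w : FL k α) : R a (c x w) = 0 := by
  have : R a ∘ₗ c x = (0 : FL k α →ₗ[k] FL k α) := hom_ext (by simp [R, h])
  exact DFunLike.congr_fun this w

/-- The homotopy identity. -/
lemma homotopy (a : α) (l : List (Finset α)) : ∀ E : Finset α, a ∈ E → PL E l →
    D (H a (e k l)) + H a (D (e k l)) = e k l - sh a (R a (e k l)) := by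
  induction l with
  | nil => intro E ha h; simp [PL] at h; simp [h] at ha
  | cons x l ih =>
    intro E ha h
    obtain ⟨hx, hxE, hl⟩ := h
    rw [← c_e x l]
    by_cases hax : a ∈ x
    · by_cases hxa : x = {a}
      · subst hxa
        rw [H_cons_sing, R_c_sing, D_c, map_sub, H_cons_sing]
        rcases l with _ | ⟨y, l⟩
        · simp
        · obtain ⟨hy, hyE, hl⟩ := hl
          have hay : a ∉ y := fun h => by simpa using hyE h
          have h1 : {a} ∪ y ≠ {a} := by
            intro h
            obtain ⟨b, hb⟩ := Finset.nonempty_iff_ne_empty.mpr hy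
            have : b ∈ ({a} : Finset α) := h ▸ Finset.mem_union_right _ hb
            rw [Finset.mem_singleton] at this
            exact hay (this ▸ hb)
          have h2 : ({a} ∪ y).erase a = y := by
            ext b; simp only [Finset.mem_erase, Finset.mem_union, Finset.mem_singleton]
            constructor
            · tauto
            · intro hb; exact ⟨fun h => hay (h ▸ hb), Or.inr hb⟩
          rw [← c_e y l, mer_c, map_neg, H_cons_mem _ _ (by simp) h1, h2]
          simp
      · have h0 : {a} ∪ x.erase a = x := by
          ext b; by_cases hb : b = a <;> simp [hb, hax]
        rw [H_cons_mem _ _ hax hxa, R_c_ne _ _ hxa, D_c, map_sub, map_neg, map_neg,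
          H_cons_mem _ _ hax hxa, D_c, mer_sh, D_sh, h0]
        rcases l with _ | ⟨y, l⟩
        · simp [H_nil]
        · obtain ⟨hy, hyE, hl⟩ := hl
          have hay : a ∉ y := fun h => by simpa [hax] using hyE h
          have h1 : x ∪ y ≠ {a} := by
            intro h
            apply hxa
            apply Finset.Subset.antisymm
            · rw [← h]; exact Finset.subset_union_left
            · simpa using hax
          have h2 : (x ∪ y).erase a = x.erase a ∪ y := by
            rw [Finset.erase_union_distrib, Finset.erase_eq_of_notMem hay]
          rw [← c_e y l, mer_c, mer_c, H_cons_mem _ _ (by simp [hax]) h1, h2]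
          simp
          abel
    · have hxa : x ≠ {a} := by rintro rfl; simp at hax
      have key : mer x (H a (e k l)) - H a (mer x (e k l)) = c x (sh a (R a (e k l))) := by
        rcases l with _ | ⟨y, l⟩
        · simp [H_nil, R_nil]
        · rw [← c_e y l, mer_c]
          by_cases hay : a ∈ y
          · have h1 : x ∪ y ≠ {a} := by
              intro h
              obtain ⟨b, hb⟩ := Finset.nonempty_iff_ne_empty.mpr hx
              have : b ∈ ({a} : Finset α) := h ▸ Finset.mem_union_left _ hb
              rw [Finset.mem_singleton] at this
              exact hax (this ▸ hb)
            have h2 : (x ∪ y).erase a = x ∪ y.erase a := by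
              rw [Finset.erase_union_distrib, Finset.erase_eq_of_notMem hax]
            rw [H_cons_mem _ (x ∪ y) (by simp [hay]) h1, h2]
            by_cases hya : y = {a}
            · subst hya
              rw [H_cons_sing, R_c_sing]; simp
            · rw [H_cons_mem _ _ hay hya, R_c_ne _ _ hya]; simp
          · have hya : y ≠ {a} := by rintro rfl; simp at hay
            rw [H_cons_not _ _ hay, H_cons_not _ (x ∪ y) (by simp [hax, hay]), R_c_ne _ _ hya]
            simp
      have ih' := ih (E \ x) (by simp [ha, hax]) hl
      rw [H_cons_not _ _ hax, R_c_ne _ _ hxa, D_c, map_sub, map_neg, map_neg,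
        H_cons_not _ _ hax, D_c]
      have h3 : c x (D (H a (e k l))) + c x (H a (D (e k l))) =
          c x (e k l) - c x (sh a (R a (e k l))) := by
        rw [← map_add, ih', map_sub]
      rw [← key] at h3
      rw [map_zero, sub_zero]
      rw [← sub_eq_zero] at h3 ⊢
      rw [← h3]
      abel

lemma R_D (a : α) (l : List (Finset α)) (E : Finset α) (h : PL E l) :
    R a (D (e k l)) = - D (R a (e k l)) := by
  rcases l with _ | ⟨x, l⟩
  · simp [R_nil]
  obtain ⟨hx, hxE, hl⟩ := h
  rw [← c_e x l, D_c, map_sub, map_neg]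
  have h0 : R a (mer x (e k l)) = 0 := by
    rcases l with _ | ⟨y, l⟩
    · simp
    · obtain ⟨hy, hyE, hl⟩ := hl
      rw [← c_e y l, mer_c, R_c_ne]
      intro h
      have h1 : x ⊆ {a} := h ▸ Finset.subset_union_left
      have h2 : y ⊆ {a} := h ▸ Finset.subset_union_right
      have h1' := (Finset.subset_singleton_iff.mp h1).resolve_left hx
      have h2' := (Finset.subset_singleton_iff.mp h2).resolve_left hy
      have := hyE (show a ∈ y by simp [h2'])
      simp [h1'] at this
  by_cases hxa : x = {a}
  · subst hxa
    rw [R_c_sing, R_c_sing, h0]; simp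
  · rw [R_c_ne _ _ hxa, R_c_ne _ _ hxa, h0]; simp

lemma R_sh (a : α) (l : List (Finset α)) (E : Finset α) (ha : a ∉ E) (h : PL E l) :
    R a (sh a (e k l)) = e k l := by
  rcases l with _ | ⟨x, l⟩
  · rw [sh_nil, ← c_e, R_c_sing]
  obtain ⟨hx, hxE, hl⟩ := h
  have hxa : x ≠ {a} := by rintro rfl; exact ha (hxE (by simp))
  rw [sh_cons, map_sub, ← c_e, R_c_sing, R_c_ne _ _ hxa, sub_zero]

/-- Degree `m` part of the complex of `E`. -/
noncomputable def V (k : Type) [Field k] {α : Type} [DecidableEq α] (E : Finset α) (m : ℕ) :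
    Submodule k (FL k α) := Finsupp.supported k k {l | PL E l ∧ l.length = m}

lemma e_mem {E : Finset α} {l : List (Finset α)} {m : ℕ} (h : PL E l) (h' : l.length = m) :
    e k l ∈ V k E m := Finsupp.single_mem_supported k 1 ⟨h, h'⟩

lemma V_ind {E : Finset α} {m : ℕ} {W : Submodule k (FL k α)} (f : FL k α →ₗ[k] FL k α)
    (h : ∀ l, PL E l → l.length = m → f (e k l) ∈ W) {x} (hx : x ∈ V k E m) : f x ∈ W := by
  have : V k E m ≤ W.comap f := by
    rw [V, Finsupp.supported_eq_span_single, Submodule.span_le]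
    rintro _ ⟨l, ⟨hl, hm⟩, rfl⟩
    exact h l hl hm
  exact this hx

lemma V_eq {E : Finset α} {m : ℕ} (f g : FL k α →ₗ[k] FL k α)
    (h : ∀ l, PL E l → l.length = m → f (e k l) = g (e k l)) {x} (hx : x ∈ V k E m) :
    f x = g x := by
  have := V_ind (W := ⊥) (f - g) (fun l h1 h2 => by simp [h l h1 h2]) hx
  simpa [sub_eq_zero] using this

lemma V_zero {E : Finset α} {m : ℕ} (h : ∀ l, PL E l → l.length ≠ m) {x} (hx : x ∈ V k E m) :
    x = 0 :=
  V_eq LinearMap.id 0 (fun l h1 h2 => absurd h2 (h l h1)) hx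

lemma PL_len : ∀ (l : List (Finset α)) (E : Finset α), PL E l → l.length ≤ E.card
  | [], E, _ => by simp
  | x :: l, E, ⟨hx, hxE, hl⟩ => by
    have := PL_len l _ hl
    rw [Finset.card_sdiff_of_subset hxE] at this
    have h1 := Finset.card_pos.mpr (Finset.nonempty_iff_ne_empty.mpr hx)
    have h2 := Finset.card_le_card hxE
    simp only [List.length_cons]
    omega

lemma c_mem {E x : Finset α} {m : ℕ} (hx : x ≠ ∅) (hxE : x ⊆ E) {w : FL k α}
    (hw : w ∈ V k (E \ x) m) : c x w ∈ V k E (m + 1) :=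
  V_ind _ (fun l h1 h2 => by rw [c_e]; exact e_mem ⟨hx, hxE, h1⟩ (by simp [h2])) hw

lemma sh_mem0 (a : α) (l : List (Finset α)) : ∀ E : Finset α, a ∉ E → PL E l →
    sh a (e k l) ∈ V k (insert a E) (l.length + 1) := by
  induction l with
  | nil =>
    intro E ha h
    rw [sh_nil]
    simp only [PL] at h
    exact e_mem (by simp [PL, h]) (by simp)
  | cons x l ih =>
    intro E ha h
    rw [sh_cons]
    have h' := h
    obtain ⟨hx, hxE, hl⟩ := h
    refine Submodule.sub_mem _ (e_mem ⟨by simp, by simp, ?_⟩ (by simp)) ?_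
    · have : insert a E \ {a} = E := by
        rw [Finset.sdiff_singleton_eq_erase, Finset.erase_insert ha]
      rw [this]; exact h'
    · refine c_mem hx (hxE.trans (Finset.subset_insert _ _)) ?_
      rw [Finset.insert_sdiff_of_notMem _ (fun h => ha (hxE h))]
      exact ih _ (by simp [ha]) hl

lemma sh_mem {a : α} {E : Finset α} (ha : a ∉ E) {m : ℕ} {x : FL k α} (hx : x ∈ V k E m) :
    sh a x ∈ V k (insert a E) (m + 1) :=
  V_ind _ (fun l h1 h2 => h2 ▸ sh_mem0 a l E ha h1) hx

lemma R_mem {a : α} {E : Finset α} (ha : a ∉ E) {m : ℕ} {x : FL k α}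
    (hx : x ∈ V k (insert a E) (m + 1)) : R a x ∈ V k E m := by
  refine V_ind _ (fun l h1 h2 => ?_) hx
  rcases l with _ | ⟨y, l⟩
  · simp at h2
  obtain ⟨hy, hyE, hl⟩ := h1
  rw [← c_e]
  by_cases hya : y = {a}
  · subst hya
    rw [R_c_sing]
    rw [Finset.sdiff_singleton_eq_erase, Finset.erase_insert ha] at hl
    exact e_mem hl (by simpa using h2)
  · rw [R_c_ne _ _ hya]; exact Submodule.zero_mem _

lemma H_mem0 (a : α) (l : List (Finset α)) : ∀ E : Finset α, PL E l →
    H a (e k l) ∈ V k E (l.length + 1) := by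
  induction l with
  | nil => intro E h; rw [H_nil]; exact Submodule.zero_mem _
  | cons x l ih =>
    intro E h
    obtain ⟨hx, hxE, hl⟩ := h
    rw [← c_e]
    by_cases hax : a ∈ x
    · by_cases hxa : x = {a}
      · subst hxa; rw [H_cons_sing]; exact Submodule.zero_mem _
      · rw [H_cons_mem _ _ hax hxa]
        refine Submodule.neg_mem _ (c_mem ?_ ((Finset.erase_subset _ _).trans hxE) ?_)
        · intro h
          rcases Finset.erase_eq_empty_iff _ _ |>.mp h with h | h
          · exact hx h
          · exact hxa h
        · have h1 : E \ x.erase a = insert a (E \ x) := by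
            ext b
            have := hxE hax
            by_cases hb : b = a <;> simp [hb, hax, this]
          rw [h1]
          exact sh_mem0 a l _ (by simp [hax]) hl
    · rw [H_cons_not _ _ hax]
      exact Submodule.neg_mem _ (c_mem hx hxE (ih _ hl))

lemma H_mem (a : α) {E : Finset α} {m : ℕ} {x : FL k α} (hx : x ∈ V k E m) :
    H a x ∈ V k E (m + 1) :=
  V_ind _ (fun l h1 h2 => h2 ▸ H_mem0 a l E h1) hx

lemma main (E : Finset α) :
    (∀ m, m ≠ E.card → ∀ x ∈ V k E m, D x = 0 → ∃ y ∈ V k E (m + 1), D y = x) ∧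
    (∃ z ∈ V k E E.card, z ≠ 0 ∧ D z = 0 ∧
      ∀ x ∈ V k E E.card, D x = 0 → ∃ t : k, x = t • z) := by
  induction E using Finset.induction_on with
  | empty =>
    constructor
    · intro m hm x hx _
      refine ⟨0, Submodule.zero_mem _, ?_⟩
      rw [map_zero, eq_comm]
      refine V_zero (fun l hl h => hm ?_) hx
      have := PL_len l _ hl
      simp at this ⊢
      simp [this] at h
      exact h.symm
    · refine ⟨e k [], e_mem (by simp [PL]) (by simp), by simp [e], by simp, ?_⟩
      intro x hx _
      refine ⟨x [], ?_⟩
      have hs : x.support ⊆ {[]} := by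
        intro l hl
        have := hx hl
        simpa using this.2
      rw [Finsupp.support_subset_singleton] at hs
      rw [hs]; simp [e]
  | insert a E ha ih =>
    obtain ⟨ih1, z, hzV, hz0, hDz, ih2⟩ := ih
    rw [Finset.card_insert_of_notMem ha]
    have hom : ∀ m, ∀ x ∈ V k (insert a E) m, D x = 0 → x = D (H a x) + sh a (R a x) := by
      intro m x hx hD
      have := V_eq (D ∘ₗ H a + H a ∘ₗ D) (LinearMap.id - sh (k := k) a ∘ₗ R a)
        (fun l h1 _ => homotopy a l _ (by simp) h1) hx
      simp [hD] at this
      rw [this]; abel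
    have hRD : ∀ m, ∀ x ∈ V k (insert a E) m, D x = 0 → D (R a x) = 0 := by
      intro m x hx hD
      have := V_eq (R a ∘ₗ D) (- (D (k := k) ∘ₗ R a))
        (fun l h1 _ => R_D a l _ h1) hx
      simpa [hD, eq_comm] using this
    constructor
    · rintro (_ | m) hm x hx hD
      · refine ⟨0, Submodule.zero_mem _, ?_⟩
        rw [map_zero, eq_comm]
        refine V_zero (fun l hl h => ?_) hx
        rw [List.length_eq_zero_iff] at h
        subst h
        simp [PL] at hl
      · obtain ⟨y, hy, hDy⟩ := ih1 m (by omega) _ (R_mem ha hx) (hRD _ x hx hD)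
        refine ⟨H a x - sh a y, Submodule.sub_mem _ (H_mem a hx) (sh_mem ha hy), ?_⟩
        rw [map_sub, D_sh, hDy, sub_neg_eq_add]
        exact (hom _ x hx hD).symm
    · refine ⟨sh a z, sh_mem ha hzV, ?_, by rw [D_sh, hDz]; simp, ?_⟩
      · intro h
        have := V_eq (R a ∘ₗ sh a) (LinearMap.id : FL k α →ₗ[k] FL k α)
          (fun l h1 _ => R_sh a l _ ha h1) hzV
        simp [h] at this
        exact hz0 this.symm
      · intro x hx hD
        obtain ⟨t, ht⟩ := ih2 _ (R_mem ha hx) (hRD _ x hx hD)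
        refine ⟨t, ?_⟩
        have h0 : H a x = 0 := by
          refine V_zero (fun l hl h => ?_) (H_mem a hx)
          have := PL_len l _ hl
          rw [Finset.card_insert_of_notMem ha] at this
          omega
        have := hom _ x hx hD
        rw [h0, ht] at this
        simpa using this

/-! ### Transfer to tuples -/

lemma isPart_iff : ∀ (m : ℕ) (f : Fin m → Finset α) (E : Finset α),
    IsPart E f ↔ PL E (List.ofFn f)
  | 0, f, E => by
    simp [IsPart, PL, eq_comm]
  | m + 1, f, E => by
    rw [List.ofFn_succ, PL, ← isPart_iff m]
    unfold IsPart
    rw [Fin.forall_fin_succ, Fin.univ_succ, Finset.sup_cons, Finset.sup_map]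
    constructor
    · rintro ⟨⟨h0, h1⟩, h2, h3⟩
      refine ⟨h0, ?_, h1, fun i j hij => h2 _ _ (by simpa using hij), ?_⟩
      · rw [← h3]; exact le_sup_left
      · rw [← h3]
        have hd : Disjoint (f 0) (univ.sup (f ∘ Fin.succ)) := by
          rw [Finset.disjoint_sup_right]
          intro i _
          exact h2 _ _ (Fin.succ_ne_zero i).symm
        have := Finset.union_sdiff_cancel_left hd
        exact this.symm
    · rintro ⟨h0, hE, h1, h2, h3⟩
      have hd : ∀ i : Fin m, Disjoint (f 0) (f i.succ) := by
        intro i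
        have : f i.succ ≤ E \ f 0 := by
          rw [← h3]; exact Finset.le_sup (f := fun i : Fin m => f i.succ) (Finset.mem_univ i)
        exact Finset.disjoint_of_subset_right this Finset.disjoint_sdiff
      refine ⟨⟨h0, h1⟩, ?_, ?_⟩
      · intro i j hij
        induction i using Fin.cases with
        | zero =>
          induction j using Fin.cases with
          | zero => exact absurd rfl hij
          | succ j => exact hd j
        | succ i =>
          induction j using Fin.cases with
          | zero => exact (hd i).symm
          | succ j => exact h2 i j (by simpa using hij)
      · have : f 0 ⊔ (E \ f 0) = E := Finset.union_sdiff_of_subset hE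
        rw [← h3] at this
        exact this

lemma ofFn_merge_zero (m : ℕ) (f : Fin (m + 2) → Finset α) :
    List.ofFn (merge 0 f) = (f 0 ∪ f 1) :: List.ofFn (fun i : Fin m => f i.succ.succ) := by
  rw [List.ofFn_succ]
  simp [merge]

lemma ofFn_merge_succ (m i : ℕ) (f : Fin (m + 2) → Finset α) :
    List.ofFn (merge (i + 1) f) = f 0 :: List.ofFn (merge i (fun j : Fin (m + 1) => f j.succ)) := by
  rw [List.ofFn_succ]
  simp [merge]
  rfl

lemma PL_merge : ∀ (m i : ℕ) (f : Fin (m + 1) → Finset α) (E : Finset α), i < m →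
    PL E (List.ofFn f) → PL E (List.ofFn (merge i f))
  | 0, i, f, E => by simp
  | m + 1, 0, f, E => by
    intro _ h
    rw [ofFn_merge_zero]
    rw [List.ofFn_succ, List.ofFn_succ] at h
    obtain ⟨h0, h1, h2, h3, h4⟩ := h
    refine ⟨?_, ?_, ?_⟩
    · simp [h0]
    · exact Finset.union_subset h1 (h3.trans Finset.sdiff_subset)
    · rw [sdiff_sdiff_left] at h4
      exact h4
  | m + 1, i + 1, f, E => by
    intro hi h
    rw [ofFn_merge_succ]
    rw [List.ofFn_succ] at h
    obtain ⟨h0, h1, h2⟩ := h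
    exact ⟨h0, h1, PL_merge m i _ _ (by omega) h2⟩

lemma D_ofFn : ∀ (m : ℕ) (f : Fin (m + 1) → Finset α),
    D (e k (List.ofFn f)) =
      ∑ i ∈ Finset.range m, ((-1 : k) ^ (i + 1)) • e k (List.ofFn (merge i f))
  | 0, f => by simp
  | m + 1, f => by
    rw [Finset.sum_range_succ', List.ofFn_succ, D_cons, D_ofFn m]
    simp only [ofFn_merge_succ, ofFn_merge_zero, List.ofFn_succ (f := fun i => f i.succ), mer_cons,
      map_sum, map_smul, c_e]
    rw [sub_eq_add_neg, ← Finset.sum_neg_distrib, add_comm]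
    congr 1
    · refine Finset.sum_congr rfl fun i _ => ?_
      rw [pow_succ (-1 : k) (i + 1)]; simp
    · simp

/-- Comparison map. -/
noncomputable def J (k : Type) [Field k] {α : Type} [DecidableEq α] (E : Finset α) (m : ℕ) :
    NMod k E m →ₗ[k] FL k α :=
  Finsupp.lmapDomain k k (fun q => List.ofFn q.val)

lemma J_single (E : Finset α) (m : ℕ) (q : {f : Fin m → Finset α // IsPart E f}) :
    J k E m (Finsupp.single q 1) = e k (List.ofFn q.val) := by
  simp [J, e, Finsupp.mapDomain_single]

lemma J_inj (E : Finset α) (m : ℕ) : Function.Injective (J k E m) := by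
  apply Finsupp.mapDomain_injective
  intro p q h
  exact Subtype.ext (List.ofFn_injective h)

lemma J_mem (E : Finset α) (m : ℕ) (x : NMod k E m) : J k E m x ∈ V k E m := by
  have : (⊤ : Submodule k (NMod k E m)) ≤ (V k E m).comap (J k E m) := by
    rw [← Finsupp.supported_univ, Finsupp.supported_eq_span_single, Submodule.span_le]
    rintro _ ⟨q, _, rfl⟩
    change J k E m (Finsupp.single q 1) ∈ V k E m
    rw [J_single]
    exact e_mem ((isPart_iff _ _ _).mp q.2) (by simp)
  exact this trivial

lemma J_surj (E : Finset α) (m : ℕ) (x : FL k α) (hx : x ∈ V k E m) : ∃ y, J k E m y = x := by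
  have := V_ind (W := LinearMap.range (J k E m)) LinearMap.id (fun l h1 h2 => by
    subst h2
    refine ⟨Finsupp.single ⟨l.get, (isPart_iff _ _ _).mpr (by rwa [List.ofFn_get])⟩ 1, ?_⟩
    rw [J_single]
    simp) hx
  exact this

lemma J_nD (E : Finset α) (m : ℕ) (x : NMod k E (m + 1)) :
    J k E m (nD k E m x) = D (J k E (m + 1) x) := by
  have : J k E m ∘ₗ nD k E m = D ∘ₗ J k E (m + 1) := by
    apply Finsupp.lhom_ext'
    intro q
    apply LinearMap.ext_ring
    simp only [LinearMap.comp_apply, Finsupp.lsingle_apply]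
    rw [J_single, D_ofFn, nD, Finsupp.lsum_single, LinearMap.toSpanSingleton_apply, one_smul,
      map_sum]
    refine Finset.sum_congr rfl fun i hi => ?_
    have hp : IsPart E (merge i q.val) :=
      (isPart_iff _ _ _).mpr (PL_merge _ _ _ _ (Finset.mem_range.mp hi) ((isPart_iff _ _ _).mp q.2))
    rw [map_smul, bas, dif_pos hp, J_single]
  exact DFunLike.congr_fun this x

end BarAux

/-- The homology of `(N_*, d)` vanishes in degrees `m ≠ n` and is one-dimensional
in top degree `n = |E|`. -/
theorem normalizedBar_homology (k : Type) [Field k] (α : Type) [DecidableEq α]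
    (E : Finset α) (n : ℕ) (hcard : E.card = n) (hn : 1 ≤ n) :
    (∀ x : NMod k E 0, ∃ y : NMod k E 1, nD k E 0 y = x) ∧
    (∀ (m : ℕ), m + 1 ≠ n → ∀ x : NMod k E (m + 1), nD k E m x = 0 →
      ∃ y : NMod k E (m + 2), nD k E (m + 1) y = x) ∧
    (∀ (m : ℕ), m + 1 = n → ∃ z : NMod k E (m + 1), z ≠ 0 ∧
      ∀ x : NMod k E (m + 1), nD k E m x = 0 ↔ ∃ c : k, x = c • z) := by
  subst hcard
  obtain ⟨h1, z, hzV, hz0, hDz, h2⟩ := BarAux.main (k := k) E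
  refine ⟨?_, ?_, ?_⟩
  · intro x
    refine ⟨0, ?_⟩
    rw [map_zero, eq_comm]
    apply BarAux.J_inj
    rw [map_zero]
    refine BarAux.V_zero (fun l hl h => ?_) (BarAux.J_mem E 0 x)
    rw [List.length_eq_zero_iff] at h
    subst h
    simp only [BarAux.PL] at hl
    simp [hl] at hn
  · intro m hm x hx
    obtain ⟨y, hy, hDy⟩ := h1 (m + 1) hm _ (BarAux.J_mem E _ x)
      (by rw [← BarAux.J_nD, hx, map_zero])
    obtain ⟨w, rfl⟩ := BarAux.J_surj _ _ _ hy
    refine ⟨w, BarAux.J_inj _ _ ?_⟩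
    rw [BarAux.J_nD, hDy]
  · intro m hm
    rw [← hm] at hzV h2
    obtain ⟨w, rfl⟩ := BarAux.J_surj _ _ _ hzV
    refine ⟨w, ?_, ?_⟩
    · rintro rfl
      exact hz0 (map_zero _)
    · intro x
      constructor
      · intro hx
        obtain ⟨t, ht⟩ := h2 _ (BarAux.J_mem E _ x) (by rw [← BarAux.J_nD, hx, map_zero])
        refine ⟨t, BarAux.J_inj _ _ ?_⟩
        rw [ht, map_smul]
      · rintro ⟨t, rfl⟩
        apply BarAux.J_inj
        rw [BarAux.J_nD, map_smul, map_smul, hDz, smul_zero, map_zero]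
end

section
/- Let k be a field and E = {e_1, …, e_n} a finite set with n ≥ 1 elements. Let (N_*, d) be the complex with N_m the free k-vector space on ordered partitions of E into m nonempty blocks and d(E_1, …, E_m) = Σ_{i=1}^{m−1} (−1)^{i} (E_1, …, E_i ∪ E_{i+1}, …, E_m). Then the element z = Σ_{σ ∈ S_n} sgn(σ) ({e_{σ(1)}}, …, {e_{σ(n)}}) ∈ N_n is a cycle (d z = 0), the kernel of d : N_n → N_{n−1} is the one-dimensional subspace spanned by z, and the chain map from the complex consisting of k concentrated in degree n to N_* sending 1 to z is a quasi-isomorphism. -/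
/- STATEMENT 7: for `E = {e_1, …, e_n}` with `n ≥ 1` (here `n = m + 1`), in the
normalized bar complex `N_*` of ordered partitions of `E` into nonempty blocks,
the element `z = Σ_{σ ∈ S_n} sgn(σ) ({e_{σ(1)}}, …, {e_{σ(n)}})` is a cycle, the
kernel of `d : N_n → N_{n−1}` is the one-dimensional subspace spanned by `z`, and
the chain map `k[n] → N_*` sending `1` to `z` is a quasi-isomorphism (homology of
`N_*` vanishes in every degree `≠ n`). -/

open Finset

/-- `z = Σ_{σ ∈ S_n} sgn(σ) ({e_{σ(1)}}, …, {e_{σ(n)}}) ∈ N_n` for an enumeration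
`e` of `E` with `n = m + 1` elements. -/
noncomputable def zElt (k : Type) [Field k] {α : Type} [DecidableEq α] (E : Finset α)
    (m : ℕ) (e : Fin (m + 1) → α) : NMod k E (m + 1) :=
  ∑ σ : Equiv.Perm (Fin (m + 1)),
    ((Equiv.Perm.sign σ : ℤ) : k) •
      bas k (IsPart E) (fun i : Fin (m + 1) => ({e (σ i)} : Finset α))

namespace TopCyc

set_option linter.unusedSectionVars false
set_option linter.unusedSimpArgs false

variable (k : Type) [Field k] {α : Type} [DecidableEq α]

/-- Free module on lists of blocks. -/
abbrev LV (k : Type) [Field k] (α : Type) : Type := List (Finset α) →₀ k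

/-- Basis vector. -/
noncomputable abbrev sg (L : List (Finset α)) : LV k α := Finsupp.single L 1

/-- Linear extension. -/
noncomputable def lc {W : Type} [AddCommGroup W] [Module k W] (t : List (Finset α) → W) :
    LV k α →ₗ[k] W := Finsupp.linearCombination k t

@[simp] lemma lc_sg {W : Type} [AddCommGroup W] [Module k W] (t : List (Finset α) → W)
    (L : List (Finset α)) : lc k t (sg k L) = t L := by
  simp [lc, sg]

/-- Prepend a block. -/
noncomputable def cn (A : Finset α) : LV k α →ₗ[k] LV k α := lc k fun L => sg k (A :: L)

@[simp] lemma cn_sg (A : Finset α) (L : List (Finset α)) :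
    cn k A (sg k L) = sg k (A :: L) := by simp [cn]

/-- Merge into head, on lists. -/
noncomputable def mhL (A : Finset α) : List (Finset α) → LV k α
  | [] => 0
  | B :: L => sg k ((A ∪ B) :: L)

noncomputable def mh (A : Finset α) : LV k α →ₗ[k] LV k α := lc k (mhL k A)

noncomputable def dL : List (Finset α) → LV k α
  | [] => 0
  | A :: L => - mhL k A L - cn k A (dL L)

noncomputable def D : LV k α →ₗ[k] LV k α := lc k (dL k)

noncomputable def insL (a : α) : List (Finset α) → LV k α
  | [] => sg k [{a}]
  | A :: L => sg k ({a} :: A :: L) - cn k A (insL a L)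

noncomputable def S (a : α) : LV k α →ₗ[k] LV k α := lc k (insL k a)

noncomputable def remL (a : α) : List (Finset α) → LV k α
  | [] => 0
  | A :: L => if a ∈ A then (if A = {a} then 0 else sg k (A.erase a :: L))
      else cn k A (remL a L)

noncomputable def R (a : α) : LV k α →ₗ[k] LV k α := lc k (remL k a)

noncomputable def hL (a : α) : List (Finset α) → LV k α
  | [] => 0
  | A :: L => - cn k {a} (remL k a (A :: L)) - (if a ∈ A then 0 else cn k A (hL a L))

noncomputable def H (a : α) : LV k α →ₗ[k] LV k α := lc k (hL k a)

noncomputable def eL : List (Finset α) → LV k α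
  | [] => sg k []
  | _ :: _ => 0

noncomputable def Ee : LV k α →ₗ[k] LV k α := lc k (eL k)

noncomputable def rhoL (a : α) : List (Finset α) → LV k α
  | [] => 0
  | A :: L => if A = {a} then eL k L else - cn k A (rhoL a L)

noncomputable def Rho (a : α) : LV k α →ₗ[k] LV k α := lc k (rhoL k a)

@[simp] lemma mh_sg (A : Finset α) (L : List (Finset α)) : mh k A (sg k L) = mhL k A L := by
  simp [mh]
@[simp] lemma D_sg (L : List (Finset α)) : D k (sg k L) = dL k L := by simp [D]
@[simp] lemma S_sg (a : α) (L : List (Finset α)) : S k a (sg k L) = insL k a L := by simp [S]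
@[simp] lemma R_sg (a : α) (L : List (Finset α)) : R k a (sg k L) = remL k a L := by simp [R]
@[simp] lemma H_sg (a : α) (L : List (Finset α)) : H k a (sg k L) = hL k a L := by simp [H]
@[simp] lemma Ee_sg (L : List (Finset α)) : Ee k (sg k L) = eL k L := by simp [Ee]
@[simp] lemma Rho_sg (a : α) (L : List (Finset α)) : Rho k a (sg k L) = rhoL k a L := by
  simp [Rho]

lemma ext_sg {W : Type} [AddCommGroup W] [Module k W] {f g : LV k α →ₗ[k] W}
    (h : ∀ L, f (sg k L) = g (sg k L)) (x : LV k α) : f x = g x := by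
  have : f = g := by
    apply Finsupp.lhom_ext'
    intro L
    ext
    simpa using h L
  rw [this]

lemma D_cn (A : Finset α) (x : LV k α) : D k (cn k A x) = - mh k A x - cn k A (D k x) := by
  refine ext_sg k (f := D k ∘ₗ cn k A) (g := - mh k A - cn k A ∘ₗ D k) (fun L => ?_) x
  simp [dL]

lemma mh_cn (A B : Finset α) (x : LV k α) : mh k A (cn k B x) = cn k (A ∪ B) x := by
  refine ext_sg k (f := mh k A ∘ₗ cn k B) (g := cn k (A ∪ B)) (fun L => ?_) x
  simp [mhL]

lemma S_cn (a : α) (A : Finset α) (x : LV k α) :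
    S k a (cn k A x) = cn k {a} (cn k A x) - cn k A (S k a x) := by
  refine ext_sg k (f := S k a ∘ₗ cn k A) (g := cn k {a} ∘ₗ cn k A - cn k A ∘ₗ S k a)
    (fun L => ?_) x
  simp [insL]

lemma R_cn_not (a : α) (A : Finset α) (h : a ∉ A) (x : LV k α) :
    R k a (cn k A x) = cn k A (R k a x) := by
  refine ext_sg k (f := R k a ∘ₗ cn k A) (g := cn k A ∘ₗ R k a) (fun L => ?_) x
  simp [remL, h]

lemma R_cn_self (a : α) (x : LV k α) : R k a (cn k {a} x) = 0 := by
  refine ext_sg k (f := R k a ∘ₗ cn k {a}) (g := 0) (fun L => ?_) x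
  simp [remL]

lemma R_cn_big (a : α) (A : Finset α) (h : a ∈ A) (h' : A ≠ {a}) (x : LV k α) :
    R k a (cn k A x) = cn k (A.erase a) x := by
  refine ext_sg k (f := R k a ∘ₗ cn k A) (g := cn k (A.erase a)) (fun L => ?_) x
  simp [remL, h, h']

lemma H_cn_not (a : α) (A : Finset α) (h : a ∉ A) (x : LV k α) :
    H k a (cn k A x) = - cn k {a} (cn k A (R k a x)) - cn k A (H k a x) := by
  refine ext_sg k (f := H k a ∘ₗ cn k A)
    (g := - (cn k {a} ∘ₗ cn k A ∘ₗ R k a) - cn k A ∘ₗ H k a) (fun L => ?_) x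
  simp [remL, hL, h]

lemma H_cn_self (a : α) (x : LV k α) : H k a (cn k {a} x) = 0 := by
  refine ext_sg k (f := H k a ∘ₗ cn k {a}) (g := 0) (fun L => ?_) x
  simp [remL, hL]

lemma H_cn_big (a : α) (A : Finset α) (h : a ∈ A) (h' : A ≠ {a}) (x : LV k α) :
    H k a (cn k A x) = - cn k {a} (cn k (A.erase a) x) := by
  refine ext_sg k (f := H k a ∘ₗ cn k A) (g := - (cn k {a} ∘ₗ cn k (A.erase a))) (fun L => ?_) x
  simp [remL, hL, h, h']

lemma Rho_cn_self (a : α) (x : LV k α) : Rho k a (cn k {a} x) = Ee k x := by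
  refine ext_sg k (f := Rho k a ∘ₗ cn k {a}) (g := Ee k) (fun L => ?_) x
  simp [rhoL]

lemma Rho_cn_ne (a : α) (A : Finset α) (h : A ≠ {a}) (x : LV k α) :
    Rho k a (cn k A x) = - cn k A (Rho k a x) := by
  refine ext_sg k (f := Rho k a ∘ₗ cn k A) (g := - (cn k A ∘ₗ Rho k a)) (fun L => ?_) x
  simp [rhoL, h]

lemma Ee_cn (A : Finset α) (x : LV k α) : Ee k (cn k A x) = 0 := by
  refine ext_sg k (f := Ee k ∘ₗ cn k A) (g := 0) (fun L => ?_) x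
  simp [eL]

lemma sg_cons (A : Finset α) (L : List (Finset α)) : sg k (A :: L) = cn k A (sg k L) := by simp

lemma Ee_D (x : LV k α) : Ee k (D k x) = 0 := by
  have key : ∀ L, (Ee k ∘ₗ D k) (sg k L) = (0 : LV k α →ₗ[k] LV k α) (sg k L) := ?_
  · simpa only [LinearMap.comp_apply, LinearMap.zero_apply] using ext_sg k key x
  intro L
  rw [LinearMap.comp_apply, LinearMap.zero_apply]
  rcases L with _ | ⟨A, _ | ⟨B, L⟩⟩ <;> simp [dL, mhL, eL, Ee_cn]

/-- the insertion map anticommutes with the differential -/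
lemma DS (a : α) (x : LV k α) : D k (S k a x) = - S k a (D k x) := by
  refine ext_sg k (f := D k ∘ₗ S k a) (g := - (S k a ∘ₗ D k)) (fun L => ?_) x
  simp only [LinearMap.comp_apply, LinearMap.neg_apply]
  induction L with
  | nil => simp [insL, dL, mhL]
  | cons A L ih =>
    rw [sg_cons, S_cn, D_cn]
    simp only [map_sub, map_neg, D_cn, S_cn, mh_cn, ih]
    rcases L with _ | ⟨B, L⟩
    · simp [insL, mhL, dL, Finset.union_comm]
    · rw [sg_cons k B L]
      simp only [S_cn, D_cn, mh_cn, map_sub, map_neg]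
      rw [Finset.union_comm A {a}]
      abel

/-- Ordered partitions as lists. -/
def Part : Finset α → List (Finset α) → Prop
  | E, [] => E = ∅
  | E, A :: L => A ≠ ∅ ∧ A ⊆ E ∧ Part (E \ A) L

lemma remL_no (a : α) (E : Finset α) (L : List (Finset α)) (h : Part E L) (ha : a ∉ E) :
    remL k a L = 0 := by
  induction L generalizing E with
  | nil => rfl
  | cons A L ih =>
    have hA : a ∉ A := fun h' => ha (h.2.1 h')
    simp [remL, hA, ih _ h.2.2 (by simp [ha])]

lemma rhoL_no (a : α) (E : Finset α) (L : List (Finset α)) (h : Part E L) (ha : a ∉ E) :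
    rhoL k a L = 0 := by
  induction L generalizing E with
  | nil => rfl
  | cons A L ih =>
    have hA : a ∉ A := fun h' => ha (h.2.1 h')
    have hA' : A ≠ {a} := by rintro rfl; simp at hA
    simp [rhoL, hA', ih _ h.2.2 (by simp [ha])]

/-- indicator of head `{a}` -/
noncomputable def tl (a : α) : List (Finset α) → LV k α
  | [] => 0
  | A :: L => if A = {a} then sg k L else 0

lemma union_ne {a : α} {A B : Finset α} (hA : A ≠ ∅) (h : a ∉ A) : A ∪ B ≠ {a} := by
  obtain ⟨x, hx⟩ := Finset.nonempty_iff_ne_empty.2 hA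
  intro hh
  have : x ∈ ({a} : Finset α) := hh ▸ Finset.mem_union_left _ hx
  rw [Finset.mem_singleton] at this
  exact h (this ▸ hx)

lemma remD (a : α) (E : Finset α) (L : List (Finset α)) (h : Part E L) (ha : a ∈ E) :
    R k a (dL k L) - D k (remL k a L) = rhoL k a L - tl k a L := by
  induction L generalizing E with
  | nil => simp [-Finset.singleton_union, -Finset.union_singleton, dL, remL, rhoL, tl]
  | cons A L ih =>
    obtain ⟨h1, h2, h3⟩ := h
    by_cases hA : a ∈ A
    · by_cases hA' : A = {a}
      · subst hA'
        rcases L with _ | ⟨B, L⟩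
        · simp [-Finset.singleton_union, -Finset.union_singleton, dL, mhL, remL, rhoL, tl, eL]
        · obtain ⟨h4, h5, h6⟩ := h3
          have hB : a ∉ B := fun h => by simpa using h5 h
          have : B ∪ {a} ≠ {a} := union_ne h4 hB
          rw [Finset.union_comm] at this
          have e : (B ∪ {a}).erase a = B := by
            ext x; simp only [Finset.mem_erase, Finset.mem_union, Finset.mem_singleton]
            constructor
            · tauto
            · intro hx; exact ⟨fun h => hB (h ▸ hx), Or.inl hx⟩
          rw [Finset.union_comm] at e
          rw [dL, map_sub, R_cn_self]
          simp only [mhL, map_neg, R_sg]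
          simp [-Finset.singleton_union, -Finset.union_singleton, remL, rhoL, tl, eL, this, e]
      · rw [dL, map_sub, R_cn_big k a A hA hA']
        have hr := rhoL_no k a _ L h3 (by simp [hA])
        simp only [remL, hA, hA', if_true, if_false, rhoL, hr, tl]
        rw [sg_cons, D_cn]
        rcases L with _ | ⟨B, L⟩
        · simp [-Finset.singleton_union, -Finset.union_singleton, mhL, dL]
        · obtain ⟨h4, h5, h6⟩ := h3
          have hB : a ∉ B := fun h => by simpa [hA] using h5 h
          have : B ∪ A ≠ {a} := union_ne h4 hB
          rw [Finset.union_comm] at this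
          have e : (A ∪ B).erase a = A.erase a ∪ B := by
            rw [Finset.erase_union_distrib, Finset.erase_eq_of_notMem hB]
          simp [-Finset.singleton_union, -Finset.union_singleton, mhL, remL, hA, this, e]
    · have hA' : A ≠ {a} := by rintro rfl; simp at hA
      have ih := ih _ h3 (by simp [ha, hA])
      rw [dL, map_sub, R_cn_not k a A hA, sub_eq_iff_eq_add.1 ih]
      simp only [remL, hA, if_false, D_cn, rhoL, hA', tl, map_add, map_sub, map_neg]
      rcases L with _ | ⟨B, L⟩
      · simp [-Finset.singleton_union, -Finset.union_singleton, mhL, remL, tl]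
      · obtain ⟨h4, h5, h6⟩ := h3
        by_cases hB : a ∈ B
        · have hn : A ∪ B ≠ {a} := union_ne h1 hA
          have e : (A ∪ B).erase a = A ∪ B.erase a := by
            rw [Finset.erase_union_distrib, Finset.erase_eq_of_notMem hA]
          by_cases hB' : B = {a}
          · subst hB'
            simp [-Finset.singleton_union, -Finset.union_singleton, mhL, remL, hn, tl, Finset.erase_union_distrib, Finset.erase_eq_of_notMem hA]
            abel
          · simp [-Finset.singleton_union, -Finset.union_singleton, mhL, remL, hB, hB', hn, e, tl]
        · have hB' : B ≠ {a} := by rintro rfl; simp at hB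
          simp [-Finset.singleton_union, -Finset.union_singleton, mhL, remL, hA, hB, hB', tl, mh_cn]

/-- the homotopy identity -/
lemma key (a : α) (E : Finset α) (L : List (Finset α)) (h : Part E L) (ha : a ∈ E) :
    D k (hL k a L) + H k a (dL k L) + S k a (rhoL k a L) = sg k L := by
  induction L generalizing E with
  | nil => exact absurd ha (by rw [show E = ∅ from h]; simp)
  | cons A L ih =>
    obtain ⟨h1, h2, h3⟩ := h
    by_cases hA : a ∈ A
    · have hr := rhoL_no k a _ L h3 (by simp [hA])
      by_cases hA' : A = {a}
      · subst hA'
        rcases L with _ | ⟨B, L⟩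
        · simp [-Finset.singleton_union, -Finset.union_singleton, dL, mhL, remL, rhoL, hL, eL, insL]
        · obtain ⟨h4, h5, h6⟩ := h3
          have hB : a ∉ B := fun h => by simpa using h5 h
          have : B ∪ {a} ≠ {a} := union_ne h4 hB
          rw [Finset.union_comm] at this
          have e : ({a} ∪ B).erase a = B := by
            rw [Finset.erase_union_distrib, Finset.erase_eq_of_notMem hB]; simp
          rw [dL, map_sub, H_cn_self]
          simp only [mhL, map_neg, H_sg]
          simp [-Finset.singleton_union, -Finset.union_singleton, remL, rhoL, hL, eL, this, e]
      · rw [dL, map_sub, H_cn_big k a A hA hA']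
        simp only [hL, remL, hA, hA', if_true, if_false, rhoL, hr, map_sub, map_neg, map_zero]
        rw [sg_cons, D_cn, D_cn]
        have e0 : {a} ∪ A.erase a = A := by
          rw [← Finset.insert_eq, Finset.insert_erase hA]
        rcases L with _ | ⟨B, L⟩
        · simp [-Finset.singleton_union, -Finset.union_singleton, mhL, dL, e0]
        · obtain ⟨h4, h5, h6⟩ := h3
          have hB : a ∉ B := fun h => by simpa [hA] using h5 h
          have : B ∪ A ≠ {a} := union_ne h4 hB
          rw [Finset.union_comm] at this
          have e : (A ∪ B).erase a = A.erase a ∪ B := by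
            rw [Finset.erase_union_distrib, Finset.erase_eq_of_notMem hB]
          simp [-Finset.singleton_union, -Finset.union_singleton, mhL, remL, hL, hA, this, e, e0]
          abel
    · have hA' : A ≠ {a} := by rintro rfl; simp at hA
      have haE : a ∈ E \ A := by simp [ha, hA]
      have ih := ih _ h3 haE
      have hR := sub_eq_iff_eq_add.1 (remD k a _ L h3 haE)
      rw [dL, map_sub, H_cn_not k a A hA, hR]
      rw [sg_cons, ← ih]
      simp only [hL, remL, hA, if_false, D_cn, rhoL, hA', map_add, map_sub, map_neg, S_cn, mh_cn]
      rcases L with _ | ⟨B, L⟩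
      · rw [show E \ A = ∅ from h3] at haE; simp at haE
      · have hn : A ∪ B ≠ {a} := union_ne h1 hA
        by_cases hB : a ∈ B
        · have e : (A ∪ B).erase a = A ∪ B.erase a := by
            rw [Finset.erase_union_distrib, Finset.erase_eq_of_notMem hA]
          by_cases hB' : B = {a}
          · subst hB'
            simp [-Finset.singleton_union, -Finset.union_singleton, mhL, remL, hL, hn, tl, Finset.erase_union_distrib,
              Finset.erase_eq_of_notMem hA]
            abel
          · simp [-Finset.singleton_union, -Finset.union_singleton, mhL, remL, hL, hB, hB', hn, e, tl, Finset.union_comm A {a}]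
            abel
        · have hB' : B ≠ {a} := by rintro rfl; simp at hB
          simp [-Finset.singleton_union, -Finset.union_singleton, mhL, remL, hL, hA, hB, hB', tl, mh_cn, Finset.union_comm A {a}]
          abel

lemma rhoD (a : α) (E : Finset α) (L : List (Finset α)) (h : Part E L) :
    Rho k a (dL k L) = - D k (rhoL k a L) := by
  induction L generalizing E with
  | nil => simp [-Finset.singleton_union, -Finset.union_singleton, dL, rhoL]
  | cons A L ih =>
    obtain ⟨h1, h2, h3⟩ := h
    have ih := ih _ h3
    by_cases hA' : A = {a}
    · subst hA'
      rw [dL, map_sub, Rho_cn_self, ← D_sg, Ee_D]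
      rcases L with _ | ⟨B, L⟩
      · simp [-Finset.singleton_union, -Finset.union_singleton, mhL, rhoL, eL, dL]
      · obtain ⟨h4, h5, h6⟩ := h3
        have hB : a ∉ B := fun h => by simpa using h5 h
        have : B ∪ {a} ≠ {a} := union_ne h4 hB
        rw [Finset.union_comm] at this
        simp [-Finset.singleton_union, -Finset.union_singleton, mhL, rhoL, eL, this, rhoL_no k a _ L h6 (by simp)]
    · rw [dL, map_sub, Rho_cn_ne k a A hA', ih]
      simp only [rhoL, hA', if_false, map_neg, D_cn]
      rcases L with _ | ⟨B, L⟩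
      · simp [-Finset.singleton_union, -Finset.union_singleton, mhL, rhoL]
      · obtain ⟨h4, h5, h6⟩ := h3
        have hn : A ∪ B ≠ {a} := by
          intro hh
          apply hA'
          have : A ⊆ {a} := hh ▸ Finset.subset_union_left
          exact (Finset.subset_singleton_iff.1 this).resolve_left h1
        by_cases hB' : B = {a}
        · subst hB'
          rcases L with _ | ⟨C, L⟩
          · simp [-Finset.singleton_union, -Finset.union_singleton, mhL, rhoL, eL, hn]
          · have h7 := rhoL_no k a _ _ h6 (by simp)
            rw [show mhL k A ({a} :: C :: L) = sg k ((A ∪ {a}) :: C :: L) from rfl, sg_cons,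
              Rho_cn_ne _ _ _ hn, Rho_sg, h7]
            simp [rhoL, eL]
        · simp [-Finset.singleton_union, -Finset.union_singleton, mhL, rhoL, hn, hB', mh_cn]

/-- Chains supported on ordered partitions of `E` with `j` blocks. -/
noncomputable def VV (E : Finset α) (j : ℕ) : Submodule k (LV k α) :=
  Finsupp.supported k k {L | Part E L ∧ L.length = j}

lemma sg_mem {E : Finset α} {j : ℕ} {L : List (Finset α)} (h : Part E L) (h' : L.length = j) :
    sg k L ∈ VV k E j := Finsupp.single_mem_supported k _ ⟨h, h'⟩

lemma VV_span (E : Finset α) (j : ℕ) :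
    VV k E j = Submodule.span k (sg k '' {L | Part E L ∧ L.length = j}) := by
  rw [VV, Finsupp.supported_eq_span_single]

lemma map_mem {W : Type} [AddCommGroup W] [Module k W] {E : Finset α} {j : ℕ}
    (T : LV k α →ₗ[k] W) (U : Submodule k W)
    (h : ∀ L, Part E L → L.length = j → T (sg k L) ∈ U) {x : LV k α} (hx : x ∈ VV k E j) :
    T x ∈ U := by
  rw [VV_span] at hx
  have : Submodule.span k (sg k '' {L | Part E L ∧ L.length = j}) ≤ U.comap T := by
    rw [Submodule.span_le]
    rintro _ ⟨L, ⟨h1, h2⟩, rfl⟩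
    exact h L h1 h2
  exact this hx

lemma eq_on {W : Type} [AddCommGroup W] [Module k W] {E : Finset α} {j : ℕ}
    (T T' : LV k α →ₗ[k] W)
    (h : ∀ L, Part E L → L.length = j → T (sg k L) = T' (sg k L)) {x : LV k α}
    (hx : x ∈ VV k E j) : T x = T' x := by
  have := map_mem k (T - T') ⊥ (fun L h1 h2 => by simp [h L h1 h2]) hx
  simpa [sub_eq_zero] using this

lemma cn_mem {E A : Finset α} {j : ℕ} (h1 : A ≠ ∅) (h2 : A ⊆ E) {x : LV k α}
    (hx : x ∈ VV k (E \ A) j) : cn k A x ∈ VV k E (j + 1) := by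
  refine map_mem k _ _ (fun L h h' => ?_) hx
  rw [cn_sg]
  exact sg_mem k ⟨h1, h2, h⟩ (by simp [h'])

lemma erase_ne {A : Finset α} {a : α} (hA : a ∈ A) (h : A ≠ {a}) : A.erase a ≠ ∅ := by
  intro h'
  rcases (Finset.erase_eq_empty_iff A a).1 h' with h'' | h''
  · simp [h''] at hA
  · exact h h''

lemma remL_mem (a : α) {E : Finset α} {L : List (Finset α)} (h : Part E L) :
    remL k a L ∈ VV k (E.erase a) L.length := by
  induction L generalizing E with
  | nil => exact Submodule.zero_mem _
  | cons A L ih =>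
    obtain ⟨h1, h2, h3⟩ := h
    rw [remL]
    split_ifs with hA hA'
    · exact Submodule.zero_mem _
    · refine sg_mem k ⟨erase_ne hA hA', Finset.erase_subset_erase _ h2, ?_⟩ (by simp)
      convert h3 using 1
      ext x; simp only [Finset.mem_sdiff, Finset.mem_erase]
      constructor
      · tauto
      · rintro ⟨h, h'⟩; exact ⟨⟨fun hh => h' (hh ▸ hA), h⟩, fun hh => h' hh.2⟩
    · refine cn_mem k h1 (fun x hx => Finset.mem_erase.2 ⟨fun hh => hA (by rwa [← hh]), h2 hx⟩) ?_
      convert ih h3 using 2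
      ext x; simp only [Finset.mem_sdiff, Finset.mem_erase]; tauto

lemma hL_mem (a : α) {E : Finset α} {L : List (Finset α)} (h : Part E L) (ha : a ∈ E) :
    hL k a L ∈ VV k E (L.length + 1) := by
  induction L generalizing E with
  | nil => exact Submodule.zero_mem _
  | cons A L ih =>
    have hr : cn k {a} (remL k a (A :: L)) ∈ VV k E ((A :: L).length + 1) := by
      refine cn_mem k (by simp) (by simpa using ha) ?_
      convert remL_mem k a h using 2
      rw [Finset.erase_eq]
    obtain ⟨h1, h2, h3⟩ := h
    rw [hL]
    refine Submodule.sub_mem _ (Submodule.neg_mem _ hr) ?_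
    split_ifs with hA
    · exact Submodule.zero_mem _
    · exact cn_mem k h1 h2 (ih h3 (by simp [ha, hA]))

lemma insL_mem (a : α) {E : Finset α} {L : List (Finset α)} (h : Part E L) (ha : a ∉ E) :
    insL k a L ∈ VV k (insert a E) (L.length + 1) := by
  induction L generalizing E with
  | nil =>
    refine sg_mem k ⟨by simp, by simp, ?_⟩ (by simp)
    rw [show E = ∅ from h]; simp [Part]
  | cons A L ih =>
    have h' := h
    obtain ⟨h1, h2, h3⟩ := h
    rw [insL]
    refine Submodule.sub_mem _ (sg_mem k ⟨by simp, by simp, ?_⟩ (by simp)) ?_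
    · convert h' using 1
      ext x; simp only [Finset.mem_sdiff, Finset.mem_insert, Finset.mem_singleton]
      constructor
      · tauto
      · intro hx; exact ⟨Or.inr hx, fun hh => ha (hh ▸ hx)⟩
    · refine cn_mem k h1 (h2.trans (Finset.subset_insert _ _)) ?_
      have hh := ih h3 (by simp [ha])
      rwa [← Finset.insert_sdiff_of_notMem _ (fun hh => ha (h2 hh))] at hh

lemma rhoL_mem (a : α) {E : Finset α} {L : List (Finset α)} {j : ℕ} (h : Part E L)
    (hj : L.length = j + 1) (ha : a ∈ E) : rhoL k a L ∈ VV k (E.erase a) j := by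
  induction L generalizing E j with
  | nil => simp at hj
  | cons A L ih =>
    obtain ⟨h1, h2, h3⟩ := h
    rw [rhoL]
    split_ifs with hA'
    · subst hA'
      rcases L with _ | ⟨B, L⟩
      · simp only [List.length_cons, List.length_nil, zero_add, Nat.add_eq_right] at hj
        refine sg_mem k ?_ (by simp only [List.length_nil]; omega)
        rw [Finset.erase_eq]; exact h3
      · exact Submodule.zero_mem _
    · refine Submodule.neg_mem _ ?_
      by_cases hA : a ∈ A
      · rw [rhoL_no k a _ L h3 (by simp [hA])]; simp
      · rcases j with _ | j
        · simp only [List.length_cons, zero_add, Nat.add_eq_right, List.length_eq_zero_iff] at hj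
          subst hj; simp [rhoL]
        · refine cn_mem k h1 (fun x hx => Finset.mem_erase.2 ⟨fun hh => hA (by rwa [← hh]), h2 hx⟩) ?_
          convert ih h3 (by simpa using hj) (by simp [ha, hA]) using 2
          ext x; simp only [Finset.mem_sdiff, Finset.mem_erase]; tauto

lemma Part.length_le {E : Finset α} {L : List (Finset α)} (h : Part E L) :
    L.length ≤ E.card := by
  induction L generalizing E with
  | nil => simp
  | cons A L ih =>
    obtain ⟨h1, h2, h3⟩ := h
    have := ih h3
    rw [Finset.card_sdiff_of_subset h2] at this
    have h4 := Finset.card_le_card h2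
    have h5 := Finset.card_pos.2 (Finset.nonempty_iff_ne_empty.2 h1)
    simp only [List.length_cons]; omega

lemma VV_zero {E : Finset α} {j : ℕ} (h : ∀ L, Part E L → L.length = j → False) {x : LV k α}
    (hx : x ∈ VV k E j) : x = 0 := by
  have := eq_on k LinearMap.id 0 (fun L h1 h2 => (h L h1 h2).elim) hx
  simpa using this

/-- decomposition of a cycle -/
lemma decomp (a : α) {E : Finset α} (ha : a ∉ E) {j : ℕ} {x : LV k α}
    (hx : x ∈ VV k (insert a E) (j + 1)) (hd : D k x = 0) :
    Rho k a x ∈ VV k E j ∧ D k (Rho k a x) = 0 ∧ H k a x ∈ VV k (insert a E) (j + 2) ∧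
      x = D k (H k a x) + S k a (Rho k a x) := by
  refine ⟨?_, ?_, ?_, ?_⟩
  · refine map_mem k _ _ (fun L h1 h2 => ?_) hx
    have := rhoL_mem k a h1 h2 (by simp)
    rwa [Finset.erase_insert ha, ← Rho_sg] at this
  · have := eq_on k (Rho k a ∘ₗ D k) (- (D k ∘ₗ Rho k a))
      (fun L h1 h2 => by simp [rhoD k a _ L h1]) hx
    simp only [LinearMap.comp_apply, LinearMap.neg_apply, hd, map_zero] at this
    exact neg_eq_zero.1 this.symm
  · refine map_mem k _ _ (fun L h1 h2 => ?_) hx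
    rw [H_sg]
    have hh := hL_mem k a h1 (by simp)
    rwa [h2] at hh
  · have := eq_on k (D k ∘ₗ H k a + H k a ∘ₗ D k + S k a ∘ₗ Rho k a) LinearMap.id
      (fun L h1 h2 => by
        simp only [LinearMap.add_apply, LinearMap.comp_apply, H_sg, D_sg, Rho_sg,
          LinearMap.id_apply]
        exact key k a _ L h1 (by simp)) hx
    simp only [LinearMap.add_apply, LinearMap.comp_apply, LinearMap.id_apply, hd, map_zero,
      add_zero] at this
    exact this.symm

lemma S_mem (a : α) {E : Finset α} (ha : a ∉ E) {j : ℕ} {x : LV k α} (hx : x ∈ VV k E j) :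
    S k a x ∈ VV k (insert a E) (j + 1) := by
  refine map_mem k _ _ (fun L h1 h2 => ?_) hx
  rw [S_sg, ← h2]
  exact insL_mem k a h1 ha

lemma exact_below (E : Finset α) : ∀ (j : ℕ), j ≠ E.card → ∀ x ∈ VV k E j, D k x = 0 →
    ∃ y ∈ VV k E (j + 1), D k y = x := by
  induction E using Finset.induction_on with
  | empty =>
    intro j hj x hx _
    refine ⟨0, Submodule.zero_mem _, ?_⟩
    rw [map_zero, VV_zero k _ hx]
    intro L h1 h2
    have := h1.length_le
    simp at this hj
    simp [this] at h2
    exact hj h2.symm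
  | insert a E ha ih =>
    intro j hj x hx hd
    rcases j with _ | j
    · refine ⟨0, Submodule.zero_mem _, ?_⟩
      rw [map_zero, VV_zero k _ hx]
      intro L h1 h2
      rw [List.length_eq_zero_iff] at h2
      subst h2
      exact Finset.insert_ne_empty _ _ h1
    · obtain ⟨h1, h2, h3, h4⟩ := decomp k a ha hx hd
      rw [Finset.card_insert_of_notMem ha] at hj
      obtain ⟨y, hy, hy'⟩ := ih j (by omega) _ h1 h2
      refine ⟨H k a x - S k a y, Submodule.sub_mem _ h3 (S_mem k a ha hy), ?_⟩
      rw [map_sub, DS, hy', sub_neg_eq_add, ← h4]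

lemma top_dim (E : Finset α) : ∃ w : LV k α, ∀ x ∈ VV k E E.card, D k x = 0 →
    ∃ c : k, x = c • w := by
  induction E using Finset.induction_on with
  | empty =>
    refine ⟨sg k [], fun x hx _ => ?_⟩
    have := map_mem k LinearMap.id (Submodule.span k {sg k []}) (fun L h1 h2 => ?_) hx
    · obtain ⟨c, hc⟩ := Submodule.mem_span_singleton.1 this
      exact ⟨c, hc.symm⟩
    · simp only [Finset.card_empty, List.length_eq_zero_iff] at h2
      subst h2
      exact Submodule.mem_span_singleton_self _
  | insert a E ha ih =>
    obtain ⟨w, hw⟩ := ih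
    refine ⟨S k a w, fun x hx hd => ?_⟩
    have hc := Finset.card_insert_of_notMem ha
    rw [hc] at hx
    obtain ⟨h1, h2, h3, h4⟩ := decomp k a ha hx hd
    have h5 : H k a x = 0 := VV_zero k (fun L h h' => by have := h.length_le; omega) h3
    obtain ⟨c, hc⟩ := hw _ h1 h2
    refine ⟨c, ?_⟩
    rw [h5, map_zero, zero_add, hc, map_smul] at h4
    exact h4

/-! ### transfer to tuples -/

lemma isPart_succ {r : ℕ} (E : Finset α) (f : Fin (r + 1) → Finset α) :
    IsPart E f ↔ f 0 ≠ ∅ ∧ f 0 ⊆ E ∧ IsPart (E \ f 0) (fun i => f i.succ) := by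
  have hs : Finset.univ.sup f = f 0 ∪ Finset.univ.sup (fun i : Fin r => f i.succ) := by
    ext x; simp [Finset.mem_sup, Fin.exists_fin_succ]
  unfold IsPart
  constructor
  · rintro ⟨h1, h2, h3⟩
    refine ⟨h1 0, ?_, fun i => h1 _, fun i j hij => h2 _ _ (by simpa using hij), ?_⟩
    · rw [← h3, hs]; exact Finset.subset_union_left
    · rw [← h3, hs, Finset.union_sdiff_left]
      symm
      rw [Finset.sdiff_eq_self_iff_disjoint, Finset.disjoint_sup_left]
      intro i _
      exact h2 _ _ (Fin.succ_ne_zero i)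
  · rintro ⟨h1, h2, h3, h4, h5⟩
    have h6 : ∀ i : Fin r, Disjoint (f 0) (f i.succ) := by
      intro i
      have : f i.succ ⊆ E \ f 0 := by
        rw [← h5]; exact Finset.le_sup (f := fun i : Fin r => f i.succ) (Finset.mem_univ i)
      exact Finset.disjoint_of_subset_right this Finset.disjoint_sdiff
    refine ⟨?_, ?_, ?_⟩
    · intro i
      induction i using Fin.cases with
      | zero => exact h1
      | succ i => exact h3 i
    · intro i j hij
      induction i using Fin.cases with
      | zero =>
        induction j using Fin.cases with
        | zero => exact absurd rfl hij
        | succ j => exact h6 j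
      | succ i =>
        induction j using Fin.cases with
        | zero => exact (h6 i).symm
        | succ j => exact h4 i j (by simpa using hij)
    · rw [hs, h5, Finset.union_sdiff_of_subset h2]

lemma isPart_iff {r : ℕ} (E : Finset α) (f : Fin r → Finset α) :
    IsPart E f ↔ Part E (List.ofFn f) := by
  induction r generalizing E with
  | zero => simp [IsPart, Part, eq_comm]
  | succ r ih => rw [isPart_succ, List.ofFn_succ, Part, ih]

lemma ofFn_merge_zero {r : ℕ} (f : Fin (r + 2) → Finset α) :
    List.ofFn (merge 0 f) = (f 0 ∪ f 1) :: List.ofFn (fun i : Fin r => f i.succ.succ) := by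
  rw [List.ofFn_succ]
  simp [merge]

lemma ofFn_merge_succ {r : ℕ} (i : ℕ) (f : Fin (r + 2) → Finset α) :
    List.ofFn (merge (i + 1) f) = f 0 :: List.ofFn (merge i (fun j => f j.succ)) := by
  rw [List.ofFn_succ]
  congr 1
  refine congrArg List.ofFn (funext fun j => ?_)
  simp [merge]

lemma isPart_merge {r : ℕ} (i : ℕ) (hi : i < r) (E : Finset α) (f : Fin (r + 1) → Finset α)
    (h : IsPart E f) : IsPart E (merge i f) := by
  induction r generalizing E i with
  | zero => omega
  | succ r ih =>
    rw [isPart_iff]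
    obtain ⟨h1, h2, h3⟩ := (isPart_succ E f).1 h
    rcases i with _ | i
    · rw [ofFn_merge_zero]
      obtain ⟨h4, h5, h6⟩ := (isPart_succ _ _).1 h3
      refine ⟨?_, ?_, ?_⟩
      · simp [h1]
      · exact Finset.union_subset h2 (h5.trans Finset.sdiff_subset)
      · rw [isPart_iff] at h6
        convert h6 using 1
        ext x; simp only [Finset.mem_sdiff, Finset.mem_union, Fin.succ_zero_eq_one]; tauto
    · rw [ofFn_merge_succ]
      refine ⟨h1, h2, ?_⟩
      rw [← isPart_iff]
      exact ih i (by omega) _ _ h3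

lemma dL_ofFn {r : ℕ} (f : Fin (r + 1) → Finset α) :
    dL k (List.ofFn f) =
      ∑ i ∈ Finset.range r, ((-1 : k) ^ (i + 1)) • sg k (List.ofFn (merge i f)) := by
  induction r with
  | zero => simp [dL, mhL]
  | succ r ih =>
    rw [List.ofFn_succ, dL, ih, Finset.sum_range_succ', ofFn_merge_zero]
    simp only [ofFn_merge_succ]
    rw [List.ofFn_succ, mhL, map_sum]
    simp only [map_smul, cn_sg, zero_add, pow_one, neg_smul, one_smul, pow_succ (-1 : k) (_ + 1),
      mul_neg, mul_one, Finset.sum_neg_distrib]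
    rw [neg_add_eq_sub, sub_eq_add_neg, sub_eq_add_neg]
    rfl

/-- embedding into chains on lists -/
noncomputable def emb (E : Finset α) (j : ℕ) : NMod k E j →ₗ[k] LV k α :=
  Finsupp.lmapDomain k k fun q => List.ofFn q.val

lemma emb_single (E : Finset α) (j : ℕ) (q : {f : Fin j → Finset α // IsPart E f}) :
    emb k E j (Finsupp.single q 1) = sg k (List.ofFn q.val) := by
  simp [emb, sg]

lemma emb_inj (E : Finset α) (j : ℕ) : Function.Injective (emb k E j) := by
  apply Finsupp.mapDomain_injective
  intro p q h
  exact Subtype.ext (List.ofFn_injective h)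

lemma emb_mem (E : Finset α) (j : ℕ) (x : NMod k E j) : emb k E j x ∈ VV k E j := by
  induction x using Finsupp.induction_linear with
  | zero => simp
  | add x y hx hy => rw [map_add]; exact Submodule.add_mem _ hx hy
  | single q c =>
    rw [← mul_one c, ← smul_eq_mul, ← Finsupp.smul_single, map_smul, emb_single]
    exact Submodule.smul_mem _ _ (sg_mem k ((isPart_iff _ _).1 q.2) (by simp))

lemma emb_surj (E : Finset α) (j : ℕ) (y : LV k α) (hy : y ∈ VV k E j) :
    ∃ x, emb k E j x = y := by
  have := map_mem k LinearMap.id (LinearMap.range (emb k E j)) (fun L h1 h2 => ?_) hy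
  · exact this
  · subst h2
    refine ⟨Finsupp.single ⟨L.get, ?_⟩ 1, ?_⟩
    · rw [isPart_iff, List.ofFn_get]; exact h1
    · rw [emb_single]; simp

lemma emb_D (E : Finset α) (j : ℕ) (x : NMod k E (j + 1)) :
    emb k E j (nD k E j x) = D k (emb k E (j + 1) x) := by
  have : emb k E j ∘ₗ nD k E j = D k ∘ₗ emb k E (j + 1) := by
    apply Finsupp.lhom_ext'
    intro q
    ext1
    simp only [LinearMap.comp_apply, Finsupp.lsingle_apply]
    rw [emb_single, D_sg, dL_ofFn]
    simp only [nD, Finsupp.lsum_single, LinearMap.toSpanSingleton_apply, one_smul, map_sum,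
      map_smul]
    refine Finset.sum_congr rfl fun i hi => ?_
    have := isPart_merge i (Finset.mem_range.1 hi) E _ q.2
    rw [bas, dif_pos this, emb_single]
  exact LinearMap.congr_fun this x

lemma isPart_perm (E : Finset α) (m : ℕ) (e : Fin (m + 1) → α) (he : Function.Injective e)
    (hE : E = Finset.image e Finset.univ) (σ : Equiv.Perm (Fin (m + 1))) :
    IsPart E (fun i : Fin (m + 1) => ({e (σ i)} : Finset α)) := by
  refine ⟨fun i => by simp, fun i j hij => by simpa using fun h => hij (σ.injective (he h)), ?_⟩
  subst hE
  ext x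
  simp only [Finset.mem_sup, Finset.mem_univ, true_and, Finset.mem_singleton, Finset.mem_image]
  constructor
  · rintro ⟨i, rfl⟩; exact ⟨_, rfl⟩
  · rintro ⟨i, rfl⟩; exact ⟨σ.symm i, by simp⟩

lemma z_ne (E : Finset α) (m : ℕ) (e : Fin (m + 1) → α) (he : Function.Injective e)
    (hE : E = Finset.image e Finset.univ) : zElt k E m e ≠ 0 := by
  intro h
  have h1 := isPart_perm E m e he hE 1
  have h2 := DFunLike.congr_fun h ⟨_, h1⟩
  rw [zElt, Finsupp.finsetSum_apply, Finset.sum_eq_single 1] at h2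
  · rw [bas, dif_pos h1] at h2
    simp at h2
  · intro σ _ hσ
    rw [bas, dif_pos (isPart_perm E m e he hE σ), Finsupp.smul_apply, Finsupp.single_apply,
      if_neg, smul_zero]
    intro hh
    apply hσ
    ext i
    have := congr_fun (congr_arg Subtype.val hh) i
    simp only [Finset.singleton_inj] at this
    rw [he this]
  · simp

lemma z_cycle (E : Finset α) (m : ℕ) (e : Fin (m + 1) → α) (he : Function.Injective e)
    (hE : E = Finset.image e Finset.univ) : nD k E m (zElt k E m e) = 0 := by
  rw [zElt, map_sum]
  have h0 : ∀ σ : Equiv.Perm (Fin (m + 1)),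
      nD k E m (((Equiv.Perm.sign σ : ℤ) : k) •
        bas k (IsPart E) (fun i : Fin (m + 1) => ({e (σ i)} : Finset α))) =
      ∑ i ∈ Finset.range m, ((-1 : k) ^ (i + 1)) • (((Equiv.Perm.sign σ : ℤ) : k) •
        bas k (IsPart E) (merge i (fun i : Fin (m + 1) => ({e (σ i)} : Finset α)))) := by
    intro σ
    rw [map_smul, bas, dif_pos (isPart_perm E m e he hE σ)]
    simp only [nD, Finsupp.lsum_single, LinearMap.toSpanSingleton_apply, one_smul]
    rw [Finset.smul_sum]
    exact Finset.sum_congr rfl fun i _ => smul_comm _ _ _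
  rw [Finset.sum_congr rfl fun σ _ => h0 σ, Finset.sum_comm]
  refine Finset.sum_eq_zero fun i hi => ?_
  have hi := Finset.mem_range.1 hi
  rw [← Finset.smul_sum]
  have hne : (⟨i, by omega⟩ : Fin (m + 1)) ≠ ⟨i + 1, by omega⟩ := by simp
  rw [Finset.sum_involution
    (fun σ _ => σ * Equiv.swap (⟨i, by omega⟩ : Fin (m + 1)) ⟨i + 1, by omega⟩), smul_zero]
  · intro σ _
    have hm : merge i (fun j : Fin (m + 1) => ({e ((σ * Equiv.swap (⟨i, by omega⟩ : Fin (m + 1))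
        ⟨i + 1, by omega⟩) j)} : Finset α)) =
        merge i (fun j : Fin (m + 1) => ({e (σ j)} : Finset α)) := by
      funext j
      simp only [merge, Equiv.Perm.mul_apply]
      split_ifs with h1 h2
      · rw [Equiv.swap_apply_of_ne_of_ne] <;> · intro h; simp [Fin.ext_iff] at h; omega
      · have e1 : j.castSucc = ⟨i, by omega⟩ := by ext; simpa using h2
        have e2 : j.succ = ⟨i + 1, by omega⟩ := by ext; simpa using h2
        rw [e1, e2, Equiv.swap_apply_left, Equiv.swap_apply_right, Finset.union_comm]
      · rw [Equiv.swap_apply_of_ne_of_ne] <;> · intro h; simp [Fin.ext_iff] at h; omega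
    rw [hm, Equiv.Perm.sign_mul, Equiv.Perm.sign_swap hne]
    simp
  · intro σ _ _ h
    have := mul_eq_left.1 h
    exact hne (Equiv.swap_eq_one_iff.1 this)
  · intro σ _; exact Finset.mem_univ _
  · intro σ _
    rw [mul_assoc, Equiv.swap_mul_self, mul_one]

end TopCyc

/-- `z` is a cycle, `ker (d : N_n → N_{n−1})` is the one-dimensional subspace
spanned by `z`, and the chain map `k[n] → N_*`, `1 ↦ z`, is a quasi-isomorphism
(`z ≠ 0`, and the homology of `N_*` vanishes in all degrees `≠ n`), where
`n = m + 1 = |E| ≥ 1`. -/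
theorem topCycle_spans_kernel (k : Type) [Field k] (α : Type) [DecidableEq α]
    (E : Finset α) (m : ℕ) (e : Fin (m + 1) → α) (he : Function.Injective e)
    (hE : E = Finset.image e Finset.univ) :
    nD k E m (zElt k E m e) = 0 ∧
    zElt k E m e ≠ 0 ∧
    (∀ x : NMod k E (m + 1), nD k E m x = 0 ↔ ∃ c : k, x = c • zElt k E m e) ∧
    (∀ x : NMod k E 0, ∃ y : NMod k E 1, nD k E 0 y = x) ∧
    (∀ (j : ℕ), j + 1 ≠ m + 1 → ∀ x : NMod k E (j + 1), nD k E j x = 0 →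
      ∃ y : NMod k E (j + 2), nD k E (j + 1) y = x) := by
  have hcard : E.card = m + 1 := by
    rw [hE, Finset.card_image_of_injective _ he, Finset.card_univ, Fintype.card_fin]
  have hz := TopCyc.z_cycle k E m e he hE
  have hz' := TopCyc.z_ne k E m e he hE
  have hker : ∀ j (x : NMod k E (j + 1)), nD k E j x = 0 →
      TopCyc.D k (TopCyc.emb k E (j + 1) x) = 0 := by
    intro j x hx
    rw [← TopCyc.emb_D, hx, map_zero]
  refine ⟨hz, hz', ?_, ?_, ?_⟩
  · intro x
    constructor
    · intro hx
      obtain ⟨w, hw⟩ := TopCyc.top_dim k E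
      rw [hcard] at hw
      obtain ⟨c, hc⟩ := hw _ (TopCyc.emb_mem k E _ x) (hker _ _ hx)
      obtain ⟨c', hc'⟩ := hw _ (TopCyc.emb_mem k E _ (zElt k E m e)) (hker _ _ hz)
      have h0 : c' ≠ 0 := by
        rintro rfl
        apply hz'
        apply TopCyc.emb_inj k E (m + 1)
        rw [hc', zero_smul, map_zero]
      refine ⟨c * c'⁻¹, TopCyc.emb_inj k E (m + 1) ?_⟩
      rw [map_smul, hc, hc', smul_smul, mul_assoc, inv_mul_cancel₀ h0, mul_one]
    · rintro ⟨c, rfl⟩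
      rw [map_smul, hz, smul_zero]
  · intro x
    refine ⟨0, TopCyc.emb_inj k E 0 ?_⟩
    rw [map_zero, map_zero]
    refine (TopCyc.VV_zero k (fun L h1 h2 => ?_) (TopCyc.emb_mem k E 0 x)).symm
    rw [List.length_eq_zero_iff] at h2
    subst h2
    rw [show E = ∅ from h1] at hcard
    simp at hcard
  · intro j hj x hx
    obtain ⟨y, hy, hy'⟩ := TopCyc.exact_below k E (j + 1) (by rw [hcard]; exact hj) _
      (TopCyc.emb_mem k E _ x) (hker _ _ hx)
    obtain ⟨y, rfl⟩ := TopCyc.emb_surj k E _ y hy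
    refine ⟨y, TopCyc.emb_inj k E (j + 1) ?_⟩
    rw [TopCyc.emb_D, hy']
end
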